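/- (Asymptotics of the averaged radial equation.) Define J₀(z) = (1/π)·∫₀^π cos(z·sin τ) dτ and J₁(z) = (1/π)·∫₀^π cos(τ − z·sin τ) dτ. Then π·z·J₀(z)·J₁(z) + cos(2z) → 0 as z → +∞; i.e., for large z the product satisfies J₀(z)·J₁(z) ≈ −cos(2z)/(π·z), so the fixed points of the averaged radial equation ṙ = ε·J₀(r/2)·J₁(r/2) are asymptotically located near the zeros of cos r, giving quantized radii r_n ≈ π(n + 1/2). -/

import Mathlib

/-- Bessel function of the first kind of order 0, via its integral representation. -/
noncomputable def besselJ0 (z : ℝ) : ℝ :=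
  (1 / Real.pi) * ∫ τ in (0:ℝ)..Real.pi, Real.cos (z * Real.sin τ)

/-- Bessel function of the first kind of order 1, via its integral representation. -/
noncomputable def besselJ1 (z : ℝ) : ℝ :=
  (1 / Real.pi) * ∫ τ in (0:ℝ)..Real.pi, Real.cos (τ - z * Real.sin τ)

open Complex in
/-- The unimodular phase `e^{ix}`. -/
noncomputable def phase (x : ℝ) : ℂ := cexp (x * I)

lemma norm_phase (x : ℝ) : ‖phase x‖ = 1 := Complex.norm_exp_ofReal_mul_I x

lemma phase_add (x y : ℝ) : phase (x + y) = phase x * phase y := by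
  unfold phase
  rw [← Complex.exp_add]
  push_cast
  ring_nf

@[fun_prop]
lemma continuous_phase : Continuous phase := by
  unfold phase
  fun_prop

lemma phase_re (x : ℝ) : (phase x).re = Real.cos x := Complex.exp_ofReal_mul_I_re x

lemma phase_im (x : ℝ) : (phase x).im = Real.sin x := Complex.exp_ofReal_mul_I_im x

lemma hasDerivAt_phase {f : ℝ → ℝ} {f' x : ℝ} (hf : HasDerivAt f f' x) :
    HasDerivAt (fun t => phase (f t)) ((f' : ℂ) * Complex.I * phase (f x)) x := by
  unfold phase
  have h := ((hf.ofReal_comp).mul_const Complex.I).cexp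
  convert h using 1
  ring

/-- Integration by parts: non-stationary oscillatory integrals are `O(1/z)`. -/
lemma osc_bound (a b : ℝ) (φ φ' : ℝ → ℝ) (k : ℝ → ℂ)
    (hφ : ∀ x, HasDerivAt φ (φ' x) x) (hφ' : Continuous φ')
    (hk : ∀ x ∈ Set.uIcc a b, ContDiffAt ℝ 1 k x) :
    ∃ C : ℝ, ∀ z : ℝ, 0 < z →
      ‖∫ t in a..b, k t * ((φ' t : ℂ) * phase (z * φ t))‖ ≤ C / z := by
  have hk' : ∀ x ∈ Set.uIcc a b, HasDerivAt k (deriv k x) x := fun x hx =>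
    ((hk x hx).differentiableAt (by norm_num)).hasDerivAt
  have hkc : ContinuousOn (deriv k) (Set.uIcc a b) := fun x hx =>
    (ContDiffAt.derivWithin (m := 0) (hk x hx) (by simp)).continuousAt.continuousWithinAt
  have hki : IntervalIntegrable (deriv k) MeasureTheory.volume a b := hkc.intervalIntegrable
  have hφc : Continuous φ := continuous_iff_continuousAt.2 fun x => (hφ x).continuousAt
  refine ⟨‖k b‖ + ‖k a‖ + |∫ t in a..b, ‖deriv k t‖|, fun z hz => ?_⟩
  have hzc : (z : ℂ) ≠ 0 := by exact_mod_cast hz.ne'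
  have hv : ∀ x ∈ Set.uIcc a b, HasDerivAt (fun t => phase (z * φ t))
      (((z * φ' x : ℝ) : ℂ) * Complex.I * phase (z * φ x)) x := fun x _ =>
    hasDerivAt_phase ((hφ x).const_mul z)
  have key := intervalIntegral.integral_mul_deriv_eq_deriv_mul hk' hv hki
    (Continuous.intervalIntegrable (by fun_prop) _ _)
  have e : ∫ x in a..b, k x * (((z * φ' x : ℝ) : ℂ) * Complex.I * phase (z * φ x)) =
      ((z : ℂ) * Complex.I) * ∫ t in a..b, k t * ((φ' t : ℂ) * phase (z * φ t)) := by
    rw [← intervalIntegral.integral_const_mul]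
    congr 1
    ext x
    push_cast
    ring
  rw [e] at key
  have hn := congrArg norm key
  rw [norm_mul, norm_mul, Complex.norm_I, mul_one, Complex.norm_real, Real.norm_of_nonneg hz.le] at hn
  rw [le_div_iff₀ hz, mul_comm, hn]
  refine (norm_sub_le _ _).trans (add_le_add ((norm_sub_le _ _).trans ?_) ?_)
  · simp [norm_phase]
  · refine intervalIntegral.norm_integral_le_abs_integral_norm.trans ?_
    simp [norm_phase]

/-- The Fresnel integral. -/
noncomputable def fresnel (R : ℝ) : ℂ := ∫ x in (0:ℝ)..R, phase (-x ^ 2)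

/-- Auxiliary function in the Fresnel identity. -/
noncomputable def fresnelAux (R : ℝ) : ℂ :=
  ∫ t in (0:ℝ)..1, phase (-(R ^ 2 * (1 + t ^ 2))) * ((1 / (1 + t ^ 2) : ℝ) : ℂ)

lemma cont_inv : Continuous fun t : ℝ => 1 / (1 + t ^ 2) :=
  continuous_const.div (by fun_prop) fun t => by positivity

lemma fresnel_eq (R : ℝ) : fresnel R = R * ∫ t in (0:ℝ)..1, phase (-(R ^ 2 * t ^ 2)) := by
  have h := intervalIntegral.smul_integral_comp_mul_right (a := 0) (b := 1)
    (fun x : ℝ => phase (-x ^ 2)) R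
  simp only [zero_mul, one_mul] at h
  rw [fresnel, ← h, Complex.real_smul]
  congr 2
  ext t
  ring_nf

lemma hasDerivAt_fresnel (R : ℝ) : HasDerivAt fresnel (phase (-R ^ 2)) R := by
  have hc : Continuous fun x : ℝ => phase (-x ^ 2) := by fun_prop
  exact intervalIntegral.integral_hasDerivAt_right (hc.intervalIntegrable _ _)
    (hc.stronglyMeasurableAtFilter _ _) hc.continuousAt

lemma hasDerivAt_fresnelAux (R : ℝ) :
    HasDerivAt fresnelAux (-2 * Complex.I * phase (-R ^ 2) * fresnel R) R := by
  have hci := cont_inv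
  have h := (intervalIntegral.hasDerivAt_integral_of_dominated_loc_of_deriv_le
    (μ := MeasureTheory.volume) (a := 0) (b := 1) (x₀ := R)
    (bound := fun _ => 2 * (|R| + 1))
    (F := fun R t : ℝ => phase (-(R ^ 2 * (1 + t ^ 2))) * ((1 / (1 + t ^ 2) : ℝ) : ℂ))
    (F' := fun R t : ℝ => -2 * R * Complex.I * phase (-(R ^ 2 * (1 + t ^ 2))))
    (Metric.ball_mem_nhds R one_pos)
    (Filter.Eventually.of_forall fun x => Continuous.aestronglyMeasurable (by fun_prop))
    (Continuous.intervalIntegrable (by fun_prop) _ _)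
    (Continuous.aestronglyMeasurable (by fun_prop))
    (Filter.Eventually.of_forall fun t _ x hx => by
      simp only [norm_mul, norm_phase, Complex.norm_I, Complex.norm_real, norm_neg,
        Complex.norm_ofNat, mul_one, Real.norm_eq_abs]
      have h1 : |x - R| < 1 := by simpa [Real.dist_eq] using hx
      have h2 : |x| ≤ |x - R| + |R| := by simpa using abs_add_le (x - R) R
      linarith)
    (Continuous.intervalIntegrable (by fun_prop) _ _)
    (Filter.Eventually.of_forall fun t _ x _ => by
      have hd : HasDerivAt (fun x : ℝ => -(x ^ 2 * (1 + t ^ 2))) (-(2 * x * (1 + t ^ 2))) x := by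
        exact (((hasDerivAt_pow 2 x).mul_const (1 + t ^ 2)).fun_neg).congr_deriv (by norm_num)
      have h0 : (1 + (t : ℂ) ^ 2) ≠ 0 := by
        have : (1 + t ^ 2 : ℝ) ≠ 0 := by positivity
        exact_mod_cast this
      refine ((hasDerivAt_phase hd).mul_const ((1 / (1 + t ^ 2) : ℝ) : ℂ)).congr_deriv ?_
      push_cast
      field_simp)).2
  refine h.congr_deriv ?_
  rw [fresnel_eq, ← intervalIntegral.integral_const_mul, ← intervalIntegral.integral_const_mul]
  congr 1
  ext t
  rw [show -(R ^ 2 * (1 + t ^ 2)) = -R ^ 2 + -(R ^ 2 * t ^ 2) by ring, phase_add]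
  ring

lemma fresnel_identity (R : ℝ) :
    Complex.I * fresnel R ^ 2 + fresnelAux R = (Real.pi / 4 : ℝ) := by
  have hd : ∀ x, HasDerivAt (fun R => Complex.I * fresnel R ^ 2 + fresnelAux R) 0 x := fun x => by
    refine ((((hasDerivAt_fresnel x).fun_pow 2).const_mul Complex.I).fun_add (hasDerivAt_fresnelAux x)).congr_deriv ?_
    push_cast
    ring
  have h := is_const_of_deriv_eq_zero (fun x => (hd x).differentiableAt) (fun x => (hd x).deriv) R 0
  rw [h]
  have h1 : fresnel 0 = 0 := by simp [fresnel]
  have h2 : fresnelAux 0 = (Real.pi / 4 : ℝ) := by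
    unfold fresnelAux
    have : ∀ t : ℝ, phase (-((0:ℝ) ^ 2 * (1 + t ^ 2))) * ((1 / (1 + t ^ 2) : ℝ) : ℂ) =
      ((1 / (1 + t ^ 2) : ℝ) : ℂ) := fun t => by simp [phase]
    simp_rw [this]
    rw [intervalIntegral.integral_ofReal, integral_one_div_one_add_sq]
    simp
  rw [h1, h2]
  simp

lemma norm_fresnelAux_le (R : ℝ) : ‖fresnelAux R‖ ≤ 1 := by
  have h := intervalIntegral.norm_integral_le_of_norm_le_const (a := 0) (b := 1) (C := 1)
    (f := fun t : ℝ => phase (-(R ^ 2 * (1 + t ^ 2))) * ((1 / (1 + t ^ 2) : ℝ) : ℂ))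
    (fun t _ => by
      rw [norm_mul, norm_phase, one_mul, Complex.norm_real, Real.norm_of_nonneg (by positivity)]
      rw [div_le_one (by positivity)]
      nlinarith [sq_nonneg t])
  simpa [fresnelAux] using h

lemma norm_fresnel_le (R : ℝ) : ‖fresnel R‖ ≤ 2 := by
  have h := fresnel_identity R
  have h1 : Complex.I * fresnel R ^ 2 = (Real.pi / 4 : ℝ) - fresnelAux R := by
    rw [← h]; ring
  have h2 := congrArg norm h1
  rw [norm_mul, Complex.norm_I, one_mul, norm_pow] at h2
  have h3 : ‖((Real.pi / 4 : ℝ) : ℂ) - fresnelAux R‖ ≤ Real.pi / 4 + 1 := by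
    refine (norm_sub_le _ _).trans (add_le_add ?_ (norm_fresnelAux_le R))
    rw [Complex.norm_real, Real.norm_of_nonneg (by positivity)]
  have := Real.pi_le_four
  nlinarith [norm_nonneg (fresnel R)]

lemma fresnelAux_bound : ∃ C : ℝ, ∀ R : ℝ, 0 < R → ‖fresnelAux R‖ ≤ 2 / R + C / R ^ 2 := by
  obtain ⟨C, hC⟩ := osc_bound 0 1 (fun t => -t ^ 2) (fun t => -(2 * t))
    (fun t => ((t / (2 * (1 + t ^ 2)) : ℝ) : ℂ)) (fun x => (hasDerivAt_pow 2 x).fun_neg.congr_deriv (by norm_num))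
    (by fun_prop) (fun x _ => by
      refine Complex.ofRealCLM.contDiff.contDiffAt.comp x ?_
      exact ContDiffAt.div (by fun_prop) (by fun_prop) (by positivity))
  refine ⟨C, fun R hR => ?_⟩
  have hci := cont_inv
  have hc2 : Continuous fun t : ℝ => t / (2 * (1 + t ^ 2)) :=
    continuous_id.div (by fun_prop) fun t => by positivity
  have e : fresnelAux R = phase (-R ^ 2) * ((∫ t in (0:ℝ)..1, phase (-(R ^ 2 * t ^ 2))) +
      ∫ t in (0:ℝ)..1, ((t / (2 * (1 + t ^ 2)) : ℝ) : ℂ) *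
        (((-(2 * t) : ℝ) : ℂ) * phase (R ^ 2 * (-t ^ 2)))) := by
    rw [← intervalIntegral.integral_add (Continuous.intervalIntegrable (by fun_prop) _ _)
      (Continuous.intervalIntegrable (by fun_prop) _ _), ← intervalIntegral.integral_const_mul]
    unfold fresnelAux
    congr 1
    ext t
    have h0 : (1 + (t : ℂ) ^ 2) ≠ 0 := by
      have : (1 + t ^ 2 : ℝ) ≠ 0 := by positivity
      exact_mod_cast this
    rw [show -(R ^ 2 * (1 + t ^ 2)) = -R ^ 2 + -(R ^ 2 * t ^ 2) by ring, phase_add,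
      show R ^ 2 * (-t ^ 2) = -(R ^ 2 * t ^ 2) by ring]
    push_cast
    field_simp
    ring
  rw [e, norm_mul, norm_phase, one_mul]
  refine (norm_add_le _ _).trans (add_le_add ?_ (hC _ (by positivity)))
  have h := norm_fresnel_le R
  rw [fresnel_eq, norm_mul, Complex.norm_real, Real.norm_of_nonneg hR.le] at h
  rwa [le_div_iff₀ hR, mul_comm]

/-- `∫ e^{iz cos θ}` over a half period. -/
noncomputable def bE (z : ℝ) : ℂ := ∫ θ in (-(Real.pi / 2))..(Real.pi / 2), phase (z * Real.cos θ)

/-- `∫ e^{iθ} e^{iz cos θ}` over a half period. -/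
noncomputable def bE1 (z : ℝ) : ℂ :=
  ∫ θ in (-(Real.pi / 2))..(Real.pi / 2), phase θ * phase (z * Real.cos θ)

lemma integral_shift (f : ℝ → ℝ) : ∫ τ in (0:ℝ)..Real.pi, f τ =
    ∫ θ in (-(Real.pi / 2))..(Real.pi / 2), f (Real.pi / 2 - θ) := by
  rw [intervalIntegral.integral_comp_sub_left]
  congr 1 <;> ring

lemma besselJ0_eq (z : ℝ) : besselJ0 z = (1 / Real.pi) * (bE z).re := by
  have h := Complex.reCLM.intervalIntegral_comp_comm (μ := MeasureTheory.volume)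
    (a := -(Real.pi / 2)) (b := Real.pi / 2)
    (f := fun θ => phase (z * Real.cos θ)) (Continuous.intervalIntegrable (by fun_prop) _ _)
  simp only [Complex.reCLM_apply, phase_re] at h
  rw [besselJ0, integral_shift, bE, ← h]
  simp [Real.sin_pi_div_two_sub]

lemma besselJ1_eq (z : ℝ) : besselJ1 z = (1 / Real.pi) * (bE1 z).im := by
  have h := Complex.imCLM.intervalIntegral_comp_comm (μ := MeasureTheory.volume)
    (a := -(Real.pi / 2)) (b := Real.pi / 2)
    (f := fun θ => phase θ * phase (z * Real.cos θ)) (Continuous.intervalIntegrable (by fun_prop) _ _)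
  simp only [Complex.imCLM_apply, ← phase_add, phase_im] at h
  rw [besselJ1, integral_shift, bE1]
  simp only [← phase_add]
  rw [← h]
  simp only [← Real.cos_pi_div_two_sub, sub_sub, sub_sub_cancel]

lemma cos_half_pos {x : ℝ} (hx : x ∈ Set.uIcc (-(Real.pi / 2)) (Real.pi / 2)) :
    0 < Real.cos (x / 2) ∧ 0 < Real.cos (x / 4) := by
  have hp := Real.pi_pos
  rw [Set.uIcc_of_le (by linarith)] at hx
  obtain ⟨h1, h2⟩ := hx
  constructor <;> apply Real.cos_pos_of_mem_Ioo <;> constructor <;> linarith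

lemma bE1_sub : ∃ C : ℝ, ∀ z : ℝ, 0 < z → ‖bE1 z - bE z‖ ≤ C / z := by
  obtain ⟨C, hC⟩ := osc_bound (-(Real.pi / 2)) (Real.pi / 2) Real.cos (fun t => -Real.sin t)
    (fun t => ((Real.sin (t / 2) / Real.cos (t / 2) : ℝ) : ℂ) - Complex.I) Real.hasDerivAt_cos
    (by fun_prop) (fun x hx => by
      refine ContDiffAt.sub ?_ contDiffAt_const
      refine Complex.ofRealCLM.contDiff.contDiffAt.comp x ?_
      exact ContDiffAt.div (by fun_prop) (by fun_prop) (cos_half_pos hx).1.ne')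
  refine ⟨C, fun z hz => ?_⟩
  convert hC z hz using 2
  rw [bE1, bE, ← intervalIntegral.integral_sub (Continuous.intervalIntegrable (by fun_prop) _ _)
      (Continuous.intervalIntegrable (by fun_prop) _ _)]
  refine intervalIntegral.integral_congr fun t ht => ?_
  have h0 := (cos_half_pos ht).1.ne'
  have h1 : phase t = 1 + (((Real.sin (t / 2) / Real.cos (t / 2) : ℝ) : ℂ) - Complex.I) *
      ((-Real.sin t : ℝ) : ℂ) := by
    have hc : Real.cos t = 2 * Real.cos (t / 2) ^ 2 - 1 := by rw [← Real.cos_two_mul]; ring_nf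
    have hs : Real.sin t = 2 * Real.sin (t / 2) * Real.cos (t / 2) := by
      rw [← Real.sin_two_mul]; ring_nf
    have hsq := Real.sin_sq_add_cos_sq (t / 2)
    apply Complex.ext
    · simp [phase_re, -Complex.ofReal_div, -Complex.ofReal_sin, -Complex.ofReal_cos]
      rw [hc, hs]
      field_simp
      linarith
    · simp [phase_im, -Complex.ofReal_div, -Complex.ofReal_sin, -Complex.ofReal_cos]
  rw [h1]
  ring

lemma main_part (z : ℝ) (hz : 0 < z) :
    (Real.sqrt z : ℂ) * ∫ θ in (-(Real.pi / 2))..(Real.pi / 2),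
      (Real.cos (θ / 2) : ℂ) * phase (z * Real.cos θ) =
    phase z * (2 * Real.sqrt 2 * fresnel (Real.sqrt z)) := by
  have hg : Continuous fun x : ℝ => phase (-x ^ 2) := by fun_prop
  have hd : ∀ x : ℝ, HasDerivAt (fun θ => Real.sqrt (2 * z) * Real.sin (θ / 2))
      (Real.sqrt (2 * z) * (Real.cos (x / 2) * (1 / 2))) x := fun x =>
    (((hasDerivAt_id x).div_const 2).sin).const_mul _
  have h := intervalIntegral.integral_deriv_smul_comp (a := -(Real.pi / 2)) (b := Real.pi / 2)
    (fun x _ => hd x) (by fun_prop) hg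
  have hs2 : Real.sqrt (2 * z) * Real.sin (Real.pi / 2 / 2) = Real.sqrt z := by
    rw [show Real.pi / 2 / 2 = Real.pi / 4 by ring, Real.sin_pi_div_four, Real.sqrt_mul (by norm_num)]
    have := Real.mul_self_sqrt (show (0:ℝ) ≤ 2 by norm_num)
    linear_combination (Real.sqrt z / 2) * this
  have hs3 : Real.sqrt (2 * z) * Real.sin (-(Real.pi / 2) / 2) = -Real.sqrt z := by
    rw [neg_div, Real.sin_neg, mul_neg, hs2]
  rw [hs2, hs3] at h
  have hF : ∫ x in (-Real.sqrt z)..(Real.sqrt z), phase (-x ^ 2) = 2 * fresnel (Real.sqrt z) := by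
    have h1 := intervalIntegral.integral_comp_neg (a := 0) (b := Real.sqrt z)
      (fun x : ℝ => phase (-x ^ 2))
    rw [← intervalIntegral.integral_add_adjacent_intervals (b := 0) (hg.intervalIntegrable _ _)
      (hg.intervalIntegrable _ _)]
    simp only [neg_zero] at h1
    rw [← h1, fresnel]
    simp only [even_two, Even.neg_pow]
    ring
  rw [hF] at h
  have hfac : ∀ θ : ℝ, (Real.cos (θ / 2) : ℂ) * phase (z * Real.cos θ) =
      (phase z * (2 / Real.sqrt (2 * z) : ℝ)) * ((Real.sqrt (2 * z) * (Real.cos (θ / 2) * (1 / 2))) •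
        ((fun x : ℝ => phase (-x ^ 2)) ∘ (fun θ => Real.sqrt (2 * z) * Real.sin (θ / 2))) θ) := fun θ => by
    have hc : Real.cos θ = 1 - 2 * Real.sin (θ / 2) ^ 2 := by
      have := Real.cos_two_mul (θ / 2)
      have hsq := Real.sin_sq_add_cos_sq (θ / 2)
      rw [show 2 * (θ / 2) = θ by ring] at this
      linarith
    have hp : z * Real.cos θ = z + -(Real.sqrt (2 * z) * Real.sin (θ / 2)) ^ 2 := by
      rw [mul_pow, Real.sq_sqrt (by positivity), hc]; ring
    rw [hp, phase_add, Complex.real_smul]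
    have h0 : (Real.sqrt (2 * z) : ℂ) ≠ 0 := by
      exact_mod_cast (Real.sqrt_pos.2 (by positivity : 0 < 2 * z)).ne'
    simp only [Function.comp]
    push_cast
    field_simp
  simp_rw [hfac]
  rw [intervalIntegral.integral_const_mul, h]
  have hr : Real.sqrt z * (2 / Real.sqrt (2 * z)) = Real.sqrt 2 := by
    rw [Real.sqrt_mul (by norm_num)]
    have h1 := Real.sqrt_pos.2 hz
    have := Real.mul_self_sqrt (show (0:ℝ) ≤ 2 by norm_num)
    field_simp
    linarith
  rw [← hr]
  push_cast
  ring

lemma bE_sub : ∃ C : ℝ, ∀ z : ℝ, 0 < z →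
    ‖bE z - ∫ θ in (-(Real.pi / 2))..(Real.pi / 2),
      (Real.cos (θ / 2) : ℂ) * phase (z * Real.cos θ)‖ ≤ C / z := by
  obtain ⟨C, hC⟩ := osc_bound (-(Real.pi / 2)) (Real.pi / 2) Real.cos (fun t => -Real.sin t)
    (fun t => ((-(Real.sin (t / 4) / (2 * Real.cos (t / 4) * Real.cos (t / 2))) : ℝ) : ℂ))
    Real.hasDerivAt_cos (by fun_prop) (fun x hx => by
      obtain ⟨h1, h2⟩ := cos_half_pos hx
      refine Complex.ofRealCLM.contDiff.contDiffAt.comp x ?_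
      exact (ContDiffAt.div (by fun_prop) (by fun_prop) (by positivity)).neg)
  refine ⟨C, fun z hz => ?_⟩
  convert hC z hz using 2
  rw [bE, ← intervalIntegral.integral_sub (Continuous.intervalIntegrable (by fun_prop) _ _)
      (Continuous.intervalIntegrable (by fun_prop) _ _)]
  refine intervalIntegral.integral_congr fun t ht => ?_
  obtain ⟨h1, h2⟩ := cos_half_pos ht
  have key : 1 - Real.cos (t / 2) =
      -(Real.sin (t / 4) / (2 * Real.cos (t / 4) * Real.cos (t / 2))) * -Real.sin t := by
    have hs : Real.sin t = 2 * Real.sin (t / 2) * Real.cos (t / 2) := by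
      rw [← Real.sin_two_mul]; ring_nf
    have hs' : Real.sin (t / 2) = 2 * Real.sin (t / 4) * Real.cos (t / 4) := by
      rw [← Real.sin_two_mul]; ring_nf
    have hc : Real.cos (t / 2) = 1 - 2 * Real.sin (t / 4) ^ 2 := by
      have := Real.cos_two_mul (t / 4)
      have hsq := Real.sin_sq_add_cos_sq (t / 4)
      rw [show 2 * (t / 4) = t / 2 by ring] at this
      linarith
    rw [hs, hs']
    have : -(Real.sin (t / 4) / (2 * Real.cos (t / 4) * Real.cos (t / 2))) *
        -(2 * (2 * Real.sin (t / 4) * Real.cos (t / 4)) * Real.cos (t / 2)) =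
        2 * Real.sin (t / 4) ^ 2 := by
      field_simp
    rw [this, hc]
    ring
  rw [← mul_assoc, ← Complex.ofReal_mul, ← key]
  push_cast
  ring

open Filter Topology in
theorem tendsto_div_sqrt (C : ℝ) : Tendsto (fun z : ℝ => C / Real.sqrt z) atTop (𝓝 0) :=
  tendsto_const_nhds.div_atTop Real.tendsto_sqrt_atTop

lemma sqrt_mul_bound {z C : ℝ} (hz : 0 < z) {w : ℂ} (h : ‖w‖ ≤ C / z) :
    ‖(Real.sqrt z : ℂ) * w‖ ≤ C / Real.sqrt z := by
  have h1 := Real.sqrt_pos.2 hz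
  rw [norm_mul, Complex.norm_real, Real.norm_of_nonneg h1.le]
  calc _ ≤ Real.sqrt z * (C / z) := by gcongr
    _ = C / Real.sqrt z := by
      nth_rewrite 2 [← Real.mul_self_sqrt hz.le]
      field_simp

/-- **Asymptotics of the averaged radial equation.**
`π z J₀(z) J₁(z) + cos(2z) → 0` as `z → +∞`; i.e. for large `z`,
`J₀(z) J₁(z) ≈ −cos(2z)/(π z)`, so the fixed points of the averaged radial
equation `ṙ = ε J₀(r/2) J₁(r/2)` are asymptotically near the zeros of `cos r`,
giving quantized radii `r_n ≈ π(n + 1/2)`. -/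
theorem bessel_product_asymptotics :
    Filter.Tendsto
      (fun z : ℝ => Real.pi * z * besselJ0 z * besselJ1 z + Real.cos (2 * z))
      Filter.atTop (nhds 0) := by
  obtain ⟨C₁, h₁⟩ := bE_sub
  obtain ⟨C₂, h₂⟩ := bE1_sub
  obtain ⟨C₃, h₃⟩ := fresnelAux_bound
  have hpi := Real.pi_pos
  -- the explicit error bound
  have hlim : Filter.Tendsto (fun z : ℝ => (1 / Real.pi) *
      (C₁ / Real.sqrt z * ((C₁ + C₂) / Real.sqrt z) + C₁ / Real.sqrt z * 6 +
        6 * ((C₁ + C₂) / Real.sqrt z) +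
        4 * (2 / Real.sqrt z + C₃ / Real.sqrt z * (1 / Real.sqrt z)))) Filter.atTop (nhds 0) := by
    have a1 := tendsto_div_sqrt C₁
    have a2 := tendsto_div_sqrt (C₁ + C₂)
    have a3 := tendsto_div_sqrt C₃
    have a4 := tendsto_div_sqrt 2
    have a5 := tendsto_div_sqrt 1
    have := ((((a1.mul a2).add (a1.mul_const 6)).add (a2.const_mul 6)).add
      ((a4.add (a3.mul a5)).const_mul 4)).const_mul (1 / Real.pi)
    simpa using this
  refine squeeze_zero_norm' ?_ hlim
  filter_upwards [Filter.eventually_gt_atTop 0] with z hz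
  have hs := Real.sqrt_pos.2 hz
  have b1 := sqrt_mul_bound hz (h₁ z hz)
  have b2 := sqrt_mul_bound hz (h₂ z hz)
  have b3 := h₃ _ hs
  rw [mul_sub, main_part z hz] at b1
  set u : ℂ := phase z * (2 * Real.sqrt 2 * fresnel (Real.sqrt z)) with hu
  set w : ℂ := (Real.sqrt z : ℂ) * bE z with hw
  set v : ℂ := (Real.sqrt z : ℂ) * bE1 z with hv
  rw [mul_sub] at b2
  have b4 : ‖v - u‖ ≤ (C₁ + C₂) / Real.sqrt z := by
    calc ‖v - u‖ = ‖(w - u) + (v - w)‖ := by congr 1; ring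
      _ ≤ _ := norm_add_le _ _
      _ ≤ _ := by rw [add_div]; exact add_le_add b1 b2
  have hun : ‖u‖ ≤ 6 := by
    rw [hu, norm_mul, norm_phase, one_mul, norm_mul, norm_mul, Complex.norm_real,
      Real.norm_of_nonneg (by positivity), Complex.norm_ofNat]
    have hf := norm_fresnel_le (Real.sqrt z)
    have h2 : Real.sqrt 2 ≤ 1.5 := by
      rw [Real.sqrt_le_left (by norm_num)]; norm_num
    calc _ ≤ 2 * 1.5 * (2:ℝ) := by gcongr
      _ = 6 := by norm_num
  have hu2 : u ^ 2 = 8 * Complex.I * phase (2 * z) * fresnelAux (Real.sqrt z)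
      - (2 * Real.pi : ℝ) * Complex.I * phase (2 * z) := by
    have hid := fresnel_identity (Real.sqrt z)
    have hsq : (Real.sqrt 2 : ℂ) ^ 2 = 2 := by
      exact_mod_cast Real.sq_sqrt (show (0:ℝ) ≤ 2 by norm_num)
    have hI := Complex.I_sq
    rw [hu, two_mul z, phase_add]
    push_cast at hid ⊢
    linear_combination (phase z ^ 2 * 4 * fresnel (Real.sqrt z) ^ 2) * hsq +
      (-8 * Complex.I * phase z ^ 2) * hid + (8 * phase z ^ 2 * fresnel (Real.sqrt z) ^ 2) * hI
  have hprod : u.re * u.im = 4 * (Complex.I * phase (2 * z) * fresnelAux (Real.sqrt z)).im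
      - Real.pi * Real.cos (2 * z) := by
    have h := congrArg Complex.im hu2
    have e1 : (u ^ 2).im = 2 * (u.re * u.im) := by
      rw [pow_two, Complex.mul_im]; ring
    have e2 : (((2 * Real.pi : ℝ) : ℂ) * Complex.I * phase (2 * z)).im
        = 2 * Real.pi * Real.cos (2 * z) := by
      rw [mul_assoc, Complex.im_ofReal_mul]
      simp [phase_re]
    have e3 : (8 * Complex.I * phase (2 * z) * fresnelAux (Real.sqrt z)).im =
        8 * (Complex.I * phase (2 * z) * fresnelAux (Real.sqrt z)).im := by
      rw [mul_assoc, mul_assoc, mul_assoc]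
      simp [Complex.mul_im]
    rw [e1, Complex.sub_im, e2, e3] at h
    linarith
  have hX : |(Complex.I * phase (2 * z) * fresnelAux (Real.sqrt z)).im| ≤
      2 / Real.sqrt z + C₃ / Real.sqrt z * (1 / Real.sqrt z) := by
    refine (Complex.abs_im_le_norm _).trans ?_
    rw [norm_mul, norm_mul, Complex.norm_I, norm_phase, one_mul, one_mul]
    refine b3.trans (le_of_eq ?_)
    field_simp
  set X := (Complex.I * phase (2 * z) * fresnelAux (Real.sqrt z)).im
  have hJ : Real.pi * z * besselJ0 z * besselJ1 z = (1 / Real.pi) * (w.re * v.im) := by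
    rw [besselJ0_eq, besselJ1_eq, hw, hv, Complex.re_ofReal_mul, Complex.im_ofReal_mul]
    nth_rewrite 1 [← Real.mul_self_sqrt hz.le]
    field_simp
  have hfin : Real.pi * z * besselJ0 z * besselJ1 z + Real.cos (2 * z) =
      (1 / Real.pi) * ((w - u).re * (v - u).im + (w - u).re * u.im + u.re * (v - u).im + 4 * X) := by
    rw [hJ, Complex.sub_re, Complex.sub_im]
    have : Real.cos (2 * z) = (1 / Real.pi) * (4 * X - u.re * u.im) := by
      rw [hprod]; field_simp; ring
    rw [this]
    ring
  rw [hfin, Real.norm_eq_abs, abs_mul, abs_of_pos (by positivity : 0 < 1 / Real.pi)]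
  have c1 := (Complex.abs_re_le_norm (w - u)).trans b1
  have c2 := (Complex.abs_im_le_norm (v - u)).trans b4
  have c3 := (Complex.abs_re_le_norm u).trans hun
  have c4 := (Complex.abs_im_le_norm u).trans hun
  have d1 := (abs_nonneg _).trans c1
  have d2 := (abs_nonneg _).trans c2
  gcongr
  refine (abs_add_le _ _).trans (add_le_add ((abs_add_le _ _).trans
    (add_le_add ((abs_add_le _ _).trans (add_le_add ?_ ?_)) ?_)) ?_)
  · rw [abs_mul]; gcongr
  · rw [abs_mul]; gcongr
  · rw [abs_mul]; gcongr
  · rw [abs_mul, abs_of_pos (by norm_num : (0:ℝ) < 4)]; gcongr
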